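/- arXiv:math/0404141 — 2 statements merged into one kernel-verified Lean document; each statement's English description precedes it below -/
import Mathlib

section
/- Let F = ℚ(z_1,…,z_n,w_1,…,w_n) be the field of rational functions in 2n variables, with the symmetric group S_n acting diagonally (permuting the z_j's and w_j's simultaneously). Then the 2n elementary bisymmetric functions σ_{(1,0)},…,σ_{(n,0)}, σ_{(0,1)}, σ_{(1,1)},…,σ_{(n−1,1)} are algebraically independent over ℚ, and the fixed field F^{S_n} equals the subfield of F generated over ℚ by these 2n elements; in particular F^{S_n} is purely transcendental of transcendence degree 2n over ℚ. -/
open MvPolynomial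

/-- The elementary bisymmetric function `σ_{(r,s)}` in `ℚ[z_1,…,z_n,w_1,…,w_n]`:
the sum over pairs `(A,B)` of disjoint subsets of `{1,…,n}` with `|A| = r`,
`|B| = s` of `∏_{a∈A} z_a · ∏_{b∈B} w_b`. -/
noncomputable def sigmaBis (n : ℕ) (r s : ℕ) : MvPolynomial (Fin n ⊕ Fin n) ℚ :=
  ∑ A ∈ (Finset.univ : Finset (Fin n)).powersetCard r,
    ∑ B ∈ Aᶜ.powersetCard s,
      (∏ a ∈ A, X (Sum.inl a)) * ∏ b ∈ B, X (Sum.inr b)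

/-- The field `F = ℚ(z_1,…,z_n,w_1,…,w_n)` of rational functions in `2n`
variables. -/
abbrev RatFuncField (n : ℕ) : Type :=
  FractionRing (MvPolynomial (Fin n ⊕ Fin n) ℚ)

/-- The diagonal action of a permutation `π ∈ S_n` on `ℚ(z_1,…,z_n,w_1,…,w_n)`,
permuting the `z_j`'s and the `w_j`'s simultaneously. -/
noncomputable def diagPermAction (n : ℕ) (π : Equiv.Perm (Fin n)) :
    RatFuncField n ≃+* RatFuncField n :=
  IsFractionRing.ringEquivOfRingEquiv
    (MvPolynomial.renameEquiv ℚ (Equiv.sumCongr π π)).toRingEquiv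

/-- The `2n` distinguished elementary bisymmetric functions, viewed in the
field `F`: the left copy of `Fin n` indexes `σ_{(1,0)},…,σ_{(n,0)}` and the
right copy indexes `σ_{(0,1)}, σ_{(1,1)},…,σ_{(n−1,1)}`. -/
noncomputable def sigmaGens (n : ℕ) : Fin n ⊕ Fin n → RatFuncField n :=
  fun i => Sum.elim
    (fun k => algebraMap (MvPolynomial (Fin n ⊕ Fin n) ℚ) (RatFuncField n)
      (sigmaBis n (k.1 + 1) 0))
    (fun k => algebraMap (MvPolynomial (Fin n ⊕ Fin n) ℚ) (RatFuncField n)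
      (sigmaBis n k.1 1)) i

/-- Vieta's formula for the product of the differences `x - f i` over a finite set. -/
theorem prod_sub_eq_sum_powersetCard {R ι : Type*} [CommRing R] [DecidableEq ι]
    (s : Finset ι) (x : R) (f : ι → R) :
    ∏ i ∈ s, (x - f i) =
      ∑ k ∈ Finset.range (s.card + 1),
        (∑ t ∈ s.powersetCard k, ∏ i ∈ t, f i) * ((-1) ^ k * x ^ (s.card - k)) := by
  rw [Finset.prod_sub, Finset.sum_powerset]
  refine Finset.sum_congr rfl fun k _ => ?_
  rw [Finset.sum_mul]
  refine Finset.sum_congr rfl fun t ht => ?_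
  obtain ⟨hts, rfl⟩ := Finset.mem_powersetCard.mp ht
  rw [Finset.prod_const, Finset.card_sdiff_of_subset hts]
  ring

theorem sigmaBis_zero_right (n r : ℕ) :
    sigmaBis n r 0 = ∑ A ∈ (Finset.univ : Finset (Fin n)).powersetCard r,
      ∏ a ∈ A, X (Sum.inl a) := by
  simp [sigmaBis]

theorem sigmaBis_one_right (n r : ℕ) :
    sigmaBis n r 1 = ∑ b : Fin n, X (Sum.inr b) *
      ∑ A ∈ (Finset.univ.erase b).powersetCard r, ∏ a ∈ A, X (Sum.inl a) := by
  simp only [sigmaBis, Finset.powersetCard_one, Finset.sum_map, Function.Embedding.coeFn_mk,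
    Finset.prod_singleton, Finset.mul_sum]
  rw [Finset.sum_comm']
  · exact Finset.sum_congr rfl fun b _ => Finset.sum_congr rfl fun A _ => mul_comm _ _
  · intro A b
    simp only [Finset.mem_powersetCard, Finset.subset_univ, true_and, Finset.mem_compl,
      Finset.mem_univ, and_true, Finset.subset_erase]
    exact and_comm

theorem rename_sigmaBis (n r s : ℕ) (π : Equiv.Perm (Fin n)) :
    rename (Equiv.sumCongr π π) (sigmaBis n r s) = sigmaBis n r s := by
  simp only [sigmaBis, map_sum, map_mul, map_prod, rename_X]
  refine Finset.sum_equiv π.finsetCongr (by simp) fun A _ => ?_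
  refine Finset.sum_equiv π.finsetCongr (fun B => ?_) fun B _ => by simp [Finset.prod_map]
  simp only [Finset.mem_powersetCard, Finset.subset_compl_iff_disjoint_right,
    Equiv.finsetCongr_apply, Finset.card_map, Finset.disjoint_map]

theorem prod_X_inl_sub (n : ℕ) (R : Type*) [CommRing R]
    (f : MvPolynomial (Fin n ⊕ Fin n) ℚ →+* R) (x : R) :
    ∏ i, (x - f (X (Sum.inl i))) =
      ∑ k ∈ Finset.range (n + 1), f (sigmaBis n k 0) * ((-1) ^ k * x ^ (n - k)) := by
  simp [prod_sub_eq_sum_powersetCard, sigmaBis_zero_right]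

theorem X_inr_mul_prod_sub (n : ℕ) (j : Fin n) :
    (X (Sum.inr j) * ∏ i ∈ Finset.univ.erase j, (X (Sum.inl j) - X (Sum.inl i)) :
        MvPolynomial (Fin n ⊕ Fin n) ℚ) =
      ∑ k ∈ Finset.range n, sigmaBis n k 1 * ((-1) ^ k * X (Sum.inl j) ^ (n - 1 - k)) := by
  have hn : n - 1 + 1 = n := Nat.sub_add_cancel j.pos
  have h : ∀ b : Fin n, ∏ i ∈ Finset.univ.erase b,
      (X (Sum.inl j) - X (Sum.inl i) : MvPolynomial (Fin n ⊕ Fin n) ℚ) =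
      ∑ k ∈ Finset.range n, (∑ A ∈ (Finset.univ.erase b).powersetCard k,
        ∏ a ∈ A, X (Sum.inl a)) * ((-1) ^ k * X (Sum.inl j) ^ (n - 1 - k)) := fun b => by
    rw [prod_sub_eq_sum_powersetCard, Finset.card_erase_of_mem (Finset.mem_univ b),
      Finset.card_univ, Fintype.card_fin, hn]
  calc _ = ∑ b : Fin n, X (Sum.inr b) * ∏ i ∈ Finset.univ.erase b,
        (X (Sum.inl j) - X (Sum.inl i) : MvPolynomial (Fin n ⊕ Fin n) ℚ) := by
        symm
        refine Finset.sum_eq_single j (fun b _ hb => ?_) fun h => absurd (Finset.mem_univ j) h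
        rw [Finset.prod_eq_zero (Finset.mem_erase.mpr ⟨hb.symm, Finset.mem_univ j⟩) (sub_self _),
          mul_zero]
    _ = _ := by
        simp_rw [h, Finset.mul_sum (Finset.range n)]
        rw [Finset.sum_comm]
        simp_rw [sigmaBis_one_right, Finset.sum_mul (Finset.univ : Finset (Fin n)), mul_assoc]

theorem Subfield.eq_top_of_algebraMap_X_mem {σ : Type*}
    (L : Subfield (FractionRing (MvPolynomial σ ℚ)))
    (h : ∀ i, algebraMap (MvPolynomial σ ℚ) _ (X i) ∈ L) : L = ⊤ := by
  have hp (p : MvPolynomial σ ℚ) : algebraMap _ (FractionRing (MvPolynomial σ ℚ)) p ∈ L := by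
    induction p using MvPolynomial.induction_on with
    | C a =>
      have : algebraMap _ (FractionRing (MvPolynomial σ ℚ)) (C a : MvPolynomial σ ℚ) = (a : _) :=
        eq_ratCast ((algebraMap _ (FractionRing (MvPolynomial σ ℚ))).comp C) a
      exact this ▸ SubfieldClass.ratCast_mem L a
    | add p q hp hq =>
      rw [map_add]
      exact add_mem hp hq
    | mul_X p i hp =>
      rw [map_mul]
      exact mul_mem hp (h i)
  refine eq_top_iff.mpr fun x _ => ?_
  obtain ⟨a, b, -, rfl⟩ := IsFractionRing.div_surjective (A := MvPolynomial σ ℚ) x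
  exact div_mem (hp a) (hp b)

theorem diagPermAction_algebraMap (n : ℕ) (π : Equiv.Perm (Fin n))
    (p : MvPolynomial (Fin n ⊕ Fin n) ℚ) :
    diagPermAction n π (algebraMap _ _ p) =
      algebraMap _ _ (rename (Equiv.sumCongr π π) p) :=
  IsFractionRing.ringEquivOfRingEquiv_algebraMap _ p

/-- The subfield generated by the distinguished elementary bisymmetric functions. -/
noncomputable abbrev sigmaField (n : ℕ) : IntermediateField ℚ (RatFuncField n) :=
  IntermediateField.adjoin ℚ (Set.range (sigmaGens n))

theorem sigmaBis_zero_mem_sigmaField {n k : ℕ} (hk : k ≤ n) :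
    algebraMap _ (RatFuncField n) (sigmaBis n k 0) ∈ sigmaField n := by
  cases k with
  | zero => simp [sigmaBis]
  | succ k => exact IntermediateField.subset_adjoin _ _ ⟨Sum.inl ⟨k, hk⟩, rfl⟩

theorem sigmaBis_one_mem_sigmaField {n k : ℕ} (hk : k < n) :
    algebraMap _ (RatFuncField n) (sigmaBis n k 1) ∈ sigmaField n :=
  IntermediateField.subset_adjoin _ _ ⟨Sum.inr ⟨k, hk⟩, rfl⟩

theorem diagPermAction_of_mem_sigmaField {n : ℕ} (π : Equiv.Perm (Fin n)) {x : RatFuncField n}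
    (hx : x ∈ sigmaField n) : diagPermAction n π x = x := by
  induction hx using IntermediateField.adjoin_induction with
  | mem x hx =>
    obtain ⟨i | i, rfl⟩ := hx <;>
      exact (diagPermAction_algebraMap n π _).trans (congrArg _ (rename_sigmaBis n _ _ π))
  | algebraMap q => simp
  | add x y _ _ hx hy => rw [map_add, hx, hy]
  | inv x _ hx => rw [map_inv₀, hx]
  | mul x y _ _ hx hy => rw [map_mul, hx, hy]

/-- The variable `z_j` as a rational function. -/
noncomputable abbrev zVar (n : ℕ) (j : Fin n) : RatFuncField n :=
  algebraMap (MvPolynomial (Fin n ⊕ Fin n) ℚ) _ (X (Sum.inl j))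

theorem zVar_injective (n : ℕ) : Function.Injective (zVar n) :=
  (IsFractionRing.injective _ _).comp (X_injective.comp Sum.inl_injective)

theorem prod_algebraMap_X_inl_sub_ne_zero {n : ℕ} (j : Fin n) :
    algebraMap (MvPolynomial (Fin n ⊕ Fin n) ℚ) (RatFuncField n)
      (∏ i ∈ Finset.univ.erase j, (X (Sum.inl j) - X (Sum.inl i))) ≠ 0 := by
  rw [map_prod]
  refine Finset.prod_ne_zero_iff.mpr fun i hi => ?_
  rw [map_sub]
  exact sub_ne_zero.mpr fun h => (Finset.mem_erase.mp hi).1 (zVar_injective n h).symm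

theorem algebraMap_X_inr_eq_div (n : ℕ) (j : Fin n) :
    algebraMap (MvPolynomial (Fin n ⊕ Fin n) ℚ) (RatFuncField n) (X (Sum.inr j)) =
      (∑ k ∈ Finset.range n, algebraMap _ (RatFuncField n) (sigmaBis n k 1) *
        ((-1) ^ k * zVar n j ^ (n - 1 - k))) /
      ∏ i ∈ Finset.univ.erase j, (zVar n j - zVar n i) := by
  have h := prod_algebraMap_X_inl_sub_ne_zero j
  have h' := congrArg (algebraMap _ (RatFuncField n)) (X_inr_mul_prod_sub n j)
  rw [map_mul] at h'
  rw [← eq_div_iff h] at h'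
  simpa using h'

/-- A subfield containing the `z_j` and the distinguished bisymmetric functions is everything. -/
theorem subfield_eq_top {n : ℕ} (L : Subfield (RatFuncField n))
    (hK : ∀ x ∈ sigmaField n, x ∈ L) (hz : ∀ j : Fin n, zVar n j ∈ L) : L = ⊤ := by
  refine L.eq_top_of_algebraMap_X_mem ?_
  rintro (j | j)
  · exact hz j
  · rw [algebraMap_X_inr_eq_div]
    refine div_mem (sum_mem fun k hk => mul_mem
      (hK _ (sigmaBis_one_mem_sigmaField (Finset.mem_range.mp hk)))
      (mul_mem (pow_mem (neg_mem (one_mem _)) _) (pow_mem (hz j) _)))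
      (prod_mem fun i _ => sub_mem (hz j) (hz i))

/-- The polynomial over the field of bisymmetric functions whose roots are the `z_j`. -/
theorem exists_map_eq_prod_X_sub_C (n : ℕ) : ∃ p : Polynomial (sigmaField n),
    p.map (algebraMap (sigmaField n) (RatFuncField n)) =
      ∏ i : Fin n, (Polynomial.X - Polynomial.C (zVar n i)) := by
  refine ⟨∑ k : Fin (n + 1), Polynomial.C ⟨_, sigmaBis_zero_mem_sigmaField
    (Nat.lt_succ_iff.mp k.2)⟩ * ((-1) ^ k.1 * Polynomial.X ^ (n - k.1)), ?_⟩
  have h := prod_X_inl_sub n (Polynomial (RatFuncField n))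
    (Polynomial.C.comp (algebraMap _ (RatFuncField n))) Polynomial.X
  simp only [RingHom.comp_apply] at h
  rw [h, Finset.sum_range]
  simp [Polynomial.map_sum]

theorem exists_separable_isSplittingField (n : ℕ) : ∃ p : Polynomial (sigmaField n),
    p.Separable ∧ p.IsSplittingField (sigmaField n) (RatFuncField n) := by
  obtain ⟨p, hp⟩ := exists_map_eq_prod_X_sub_C n
  refine ⟨p, ?_, ?_⟩
  · rw [← Polynomial.separable_map (algebraMap (sigmaField n) (RatFuncField n)), hp]
    exact Polynomial.separable_prod_X_sub_C_iff.mpr (zVar_injective n)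
  · rw [isSplittingField_iff_intermediateField]
    constructor
    · rw [hp]
      exact Polynomial.Splits.prod fun i _ => Polynomial.Splits.X_sub_C _
    · have := subfield_eq_top
        (IntermediateField.adjoin (sigmaField n) (p.rootSet (RatFuncField n))).toSubfield
        (fun x hx => IntermediateField.algebraMap_mem _ (⟨x, hx⟩ : sigmaField n))
        (fun j => IntermediateField.subset_adjoin _ _ ?_)
      · exact eq_top_iff.mpr fun x _ => this.ge (Subfield.mem_top x)
      · rw [Polynomial.mem_rootSet', Polynomial.aeval_def, ← Polynomial.eval_map, hp,
          Polynomial.eval_prod]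
        exact ⟨Finset.prod_ne_zero_iff.mpr fun i _ => Polynomial.X_sub_C_ne_zero _,
          Finset.prod_eq_zero (Finset.mem_univ j) (by simp)⟩

/-- Every automorphism over the field of bisymmetric functions permutes the variables
diagonally. -/
theorem exists_perm_eq_diagPermAction {n : ℕ} (τ : Gal(RatFuncField n/sigmaField n)) :
    ∃ π : Equiv.Perm (Fin n), ∀ x, diagPermAction n π x = τ x := by
  obtain ⟨p, hp⟩ := exists_map_eq_prod_X_sub_C n
  have hroot (x : RatFuncField n) : Polynomial.aeval x p =
      ∏ i : Fin n, (x - zVar n i) := by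
    rw [Polynomial.aeval_def, ← Polynomial.eval_map, hp, Polynomial.eval_prod]
    simp
  have hτ (j : Fin n) : ∃ i : Fin n, zVar n i =
      τ (zVar n j) := by
    have h := Polynomial.aeval_algHom_apply τ (zVar n j) p
    have h₀ : Polynomial.aeval (zVar n j) p = 0 :=
      (hroot _).trans (Finset.prod_eq_zero (Finset.mem_univ j) (sub_self _))
    rw [hroot, h₀, map_zero] at h
    obtain ⟨i, -, hi⟩ := Finset.prod_eq_zero_iff.mp h
    exact ⟨i, (sub_eq_zero.mp hi).symm⟩
  choose f hf using hτ
  have hfi : Function.Injective f := fun a b hab =>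
    zVar_injective n (τ.injective (by rw [← hf a, ← hf b, hab]))
  let π : Equiv.Perm (Fin n) := Equiv.ofBijective f (Finite.injective_iff_bijective.mp hfi)
  refine ⟨π, fun x => ?_⟩
  have h := subfield_eq_top
    (RingHom.eqLocusField (diagPermAction n π : RatFuncField n →+* RatFuncField n)
      (τ : RatFuncField n →+* RatFuncField n))
    (fun x hx => (diagPermAction_of_mem_sigmaField π hx).trans (τ.commutes ⟨x, hx⟩).symm)
    (fun j => (diagPermAction_algebraMap n π _).trans ?_)
  · exact h.ge (Subfield.mem_top x)
  · rw [rename_X]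
    exact hf j

theorem trdeg_ratFuncField (n : ℕ) :
    Algebra.trdeg ℚ (RatFuncField n) = Cardinal.mk (Fin n ⊕ Fin n) :=
  have : Algebra.IsAlgebraic (MvPolynomial (Fin n ⊕ Fin n) ℚ) (RatFuncField n) :=
    IsLocalization.isAlgebraic _ (nonZeroDivisors _)
  ((IsTranscendenceBasis.mvPolynomial (Fin n ⊕ Fin n) ℚ).algebraMap_comp
    (A := RatFuncField n)).cardinalMk_eq_trdeg.symm

open IntermediateField.algebraAdjoinAdjoin in
theorem algebraicIndependent_sigmaGens (n : ℕ) : AlgebraicIndependent ℚ (sigmaGens n) := by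
  obtain ⟨p, -, hp⟩ := exists_separable_isSplittingField n
  have : FiniteDimensional (sigmaField n) (RatFuncField n) :=
    Polynomial.IsSplittingField.finiteDimensional _ p
  have : Algebra.IsAlgebraic (Algebra.adjoin ℚ (Set.range (sigmaGens n))) (RatFuncField n) :=
    .trans _ (sigmaField n) _
  exact (Algebra.IsAlgebraic.isTranscendenceBasis_of_le_trdeg_of_finite ℚ (sigmaGens n)
    (trdeg_ratFuncField n).ge).1

/-- The elementary bisymmetric functions
`σ_{(1,0)},…,σ_{(n,0)}, σ_{(0,1)}, σ_{(1,1)},…,σ_{(n−1,1)}` are algebraically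
independent over `ℚ`, and the fixed field `F^{S_n}` of the diagonal
`S_n`-action on `F = ℚ(z_1,…,z_n,w_1,…,w_n)` is the subfield generated over
`ℚ` by these `2n` elements; in particular `F^{S_n}` is purely transcendental
of transcendence degree `2n` over `ℚ`. -/
theorem fixedField_eq_adjoin_sigma (n : ℕ) (hn : 1 ≤ n) :
    AlgebraicIndependent ℚ (sigmaGens n) ∧
    {x : RatFuncField n | ∀ π : Equiv.Perm (Fin n), diagPermAction n π x = x} =
      (IntermediateField.adjoin ℚ (Set.range (sigmaGens n)) :
        IntermediateField ℚ (RatFuncField n)) := by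
  refine ⟨algebraicIndependent_sigmaGens n, Set.ext fun x =>
    ⟨fun hx => ?_, fun hx π => diagPermAction_of_mem_sigmaField π hx⟩⟩
  obtain ⟨p, hsep, hp⟩ := exists_separable_isSplittingField n
  have : FiniteDimensional (sigmaField n) (RatFuncField n) :=
    Polynomial.IsSplittingField.finiteDimensional _ p
  have : IsGalois (sigmaField n) (RatFuncField n) := .of_separable_splitting_field hsep
  have hbot : x ∈ (⊥ : IntermediateField (sigmaField n) (RatFuncField n)) := by
    refine (IsGalois.mem_bot_iff_fixed x).mpr fun τ => ?_
    obtain ⟨π, hπ⟩ := exists_perm_eq_diagPermAction τ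
    rw [← hπ, hx π]
  obtain ⟨y, rfl⟩ := IntermediateField.mem_bot.mp hbot
  exact y.2
end

section
/- In ℚ[z_1,…,z_n,w_1,…,w_n], the ring of bisymmetric functions (the subring of invariants under the diagonal S_n-action) is generated as a ℚ-algebra by the elementary bisymmetric functions σ_{(r,s)} with r,s ≥ 0 and 1 ≤ r+s ≤ n. -/
open MvPolynomial

/-- The subring of invariants of the diagonal `S_n`-action on
`ℚ[z_1,…,z_n,w_1,…,w_n]` (the ring of bisymmetric functions). -/
noncomputable def bisymmetricFunctions (n : ℕ) :
    Subalgebra ℚ (MvPolynomial (Fin n ⊕ Fin n) ℚ) :=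
  ⨅ π : Equiv.Perm (Fin n),
    AlgHom.equalizer
      (rename (Sum.map π π) : MvPolynomial (Fin n ⊕ Fin n) ℚ →ₐ[ℚ]
        MvPolynomial (Fin n ⊕ Fin n) ℚ)
      (AlgHom.id ℚ (MvPolynomial (Fin n ⊕ Fin n) ℚ))

/-- If a subalgebra contains `∑ i, u i` for every `u` in a submonoid of functions, then it contains
the sums `∑ e, ∏ j, g j (e j)` over injections `e`, for `g j` in that submonoid. -/
theorem sum_embedding_prod_mem {K R ι : Type*} [CommRing K] [CommRing R] [Algebra K R]
    [Fintype ι] [DecidableEq ι] (B : Subalgebra K R) (G : Submonoid (ι → R))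
    (hG : ∀ u ∈ G, ∑ i, u i ∈ B) (k : ℕ) (g : Fin k → ι → R) (hg : ∀ j, g j ∈ G) :
    ∑ e : Fin k ↪ ι, ∏ j, g j (e j) ∈ B := by
  induction k with
  | zero => simp
  | succ k ih =>
    have key : ∑ e : Fin (k + 1) ↪ ι, ∏ j, g j (e j) =
        (∑ i, g 0 i) * (∑ e : Fin k ↪ ι, ∏ j, g j.succ (e j)) -
          ∑ l : Fin k, ∑ e : Fin k ↪ ι,
            ∏ j, Function.update (fun j => g j.succ) l (g 0 * g l.succ) j (e j) := by
      rw [← (Equiv.embeddingFinSucc k ι).symm.sum_comp, Fintype.sum_sigma, Finset.sum_comm,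
        Finset.mul_sum, ← Finset.sum_sub_distrib]
      refine Finset.sum_congr rfl fun e _ => ?_
      have hupd (l : Fin k) :
          ∏ j, Function.update (fun j => g j.succ) l (g 0 * g l.succ) j (e j) =
            g 0 (e l) * ∏ j, g j.succ (e j) := by
        rw [← Finset.mul_prod_erase _ _ (Finset.mem_univ l),
          ← Finset.mul_prod_erase Finset.univ (fun j => g j.succ (e j)) (Finset.mem_univ l)]
        simp only [Function.update_self, Pi.mul_apply, mul_assoc]
        congr 2
        refine Finset.prod_congr rfl fun j hj => ?_
        rw [Function.update_of_ne (Finset.ne_of_mem_erase hj)]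
      simp only [hupd, Fin.prod_univ_succ, Equiv.coe_embeddingFinSucc_symm, Fin.cons_zero,
        Fin.cons_succ, ← Finset.sum_mul, ← sub_mul]
      congr 1
      rw [eq_sub_iff_add_eq, ← Finset.sum_map Finset.univ e (g 0),
        ← Finset.sum_subtype (Finset.univ.map e)ᶜ (by simp) (g 0), Finset.sum_compl_add_sum]
    rw [key]
    refine sub_mem (mul_mem (hG _ (hg 0)) (ih _ fun j => hg _)) (sum_mem fun l _ => ih _ fun j => ?_)
    rcases eq_or_ne j l with rfl | hj
    · simpa using mul_mem (hg 0) (hg j.succ)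
    · simpa [Function.update_of_ne hj] using hg j.succ

/-- The power sums lie in the subalgebra generated by the elementary symmetric polynomials. -/
theorem psum_mem_adjoin_esymm (σ R : Type*) [Fintype σ] [CommRing R] (k : ℕ) :
    psum σ R k ∈ Algebra.adjoin R (Set.range fun j : ℕ => esymm σ R j) := by
  obtain ⟨q, hq⟩ := esymmAlgHom_surjective (R := R) (σ := σ) le_rfl
    ⟨psum σ R k, psum_isSymmetric σ R k⟩
  have hq' : aeval (fun i : Fin (Fintype.card σ) => esymm σ R (i + 1)) q = psum σ R k := by
    rw [← esymmAlgHom_apply, hq]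
  rw [← hq']
  refine Algebra.adjoin_mono (s := Set.range fun i : Fin (Fintype.card σ) => esymm σ R (i + 1))
    ?_ ?_
  · rintro _ ⟨i, rfl⟩
    exact ⟨_, rfl⟩
  · rw [Algebra.adjoin_range_eq_range_aeval]
    exact ⟨q, rfl⟩

/-- The linear forms `z_i + T w_i`. -/
noncomputable def pencil (n : ℕ) (i : Fin n) : Polynomial (MvPolynomial (Fin n ⊕ Fin n) ℚ) :=
  Polynomial.C (X (Sum.inl i)) + Polynomial.C (X (Sum.inr i)) * Polynomial.X

theorem coeff_aeval_pencil_esymm (n r s : ℕ) :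
    (aeval (pencil n) (esymm (Fin n) ℚ (r + s))).coeff s = sigmaBis n r s := by
  have h (A t : Finset (Fin n)) :
      ((∏ i ∈ t, Polynomial.C (X (Sum.inl i))) * ∏ i ∈ A \ t,
        (Polynomial.C (X (Sum.inr i)) * Polynomial.X) :
          Polynomial (MvPolynomial (Fin n ⊕ Fin n) ℚ)).coeff s =
        if (A \ t).card = s then
          (∏ a ∈ t, X (Sum.inl a)) * ∏ b ∈ A \ t, X (Sum.inr b) else 0 := by
    rw [Finset.prod_mul_distrib, ← map_prod, ← map_prod, ← mul_assoc, ← map_mul,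
      Finset.prod_const, Polynomial.coeff_C_mul_X_pow]
    simp only [eq_comm]
  simp only [esymm, map_sum, map_prod, aeval_X, pencil, Finset.prod_add, Polynomial.finsetSum_coeff,
    h, ← Finset.sum_filter]
  rw [sigmaBis, Finset.sum_sigma', Finset.sum_sigma']
  refine Finset.sum_bij' (fun x _ => ⟨x.2, x.1 \ x.2⟩) (fun x _ => ⟨x.1 ∪ x.2, x.1⟩) ?_ ?_ ?_ ?_ ?_
  · rintro ⟨A, t⟩ hx
    simp only [Finset.mem_sigma, Finset.mem_powersetCard, Finset.mem_filter,
      Finset.mem_powerset] at hx ⊢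
    obtain ⟨⟨-, hA⟩, ht, hs⟩ := hx
    have := Finset.card_sdiff_add_card_eq_card ht
    refine ⟨⟨Finset.subset_univ _, by omega⟩, fun a ha => ?_, hs⟩
    simp_all
  · rintro ⟨A, B⟩ hx
    simp only [Finset.mem_sigma, Finset.mem_powersetCard, Finset.mem_filter,
      Finset.mem_powerset] at hx ⊢
    obtain ⟨⟨-, hA⟩, hB, hs⟩ := hx
    have hd : Disjoint A B := (Finset.subset_compl_iff_disjoint_left).1 hB
    rw [Finset.card_union_of_disjoint hd, Finset.union_sdiff_cancel_left hd]
    exact ⟨⟨Finset.subset_univ _, by omega⟩, Finset.subset_union_left, hs⟩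
  · rintro ⟨A, t⟩ hx
    simp only [Finset.mem_sigma, Finset.mem_filter, Finset.mem_powerset] at hx
    simp [Finset.union_eq_right.2 hx.2.1]
  · rintro ⟨A, B⟩ hx
    simp only [Finset.mem_sigma, Finset.mem_powersetCard] at hx
    have hd : Disjoint A B := (Finset.subset_compl_iff_disjoint_left).1 hx.2.1
    simp [Finset.union_sdiff_cancel_left hd]
  · rintro ⟨A, t⟩ _
    rfl

theorem coeff_aeval_pencil_esymm_of_lt (n j s : ℕ) (h : j < s) :
    (aeval (pencil n) (esymm (Fin n) ℚ j)).coeff s = 0 := by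
  simp only [esymm, map_sum, map_prod, aeval_X, Polynomial.finsetSum_coeff]
  refine Finset.sum_eq_zero fun A hA => Polynomial.coeff_eq_zero_of_natDegree_lt
    ((Polynomial.natDegree_prod_le _ _).trans_lt ?_)
  refine (Finset.sum_le_card_nsmul A _ 1 fun i _ => ?_).trans_lt ?_
  · rw [pencil]
    compute_degree
  · simpa [(Finset.mem_powersetCard.1 hA).2] using h

theorem coeff_aeval_pencil_psum (n a b : ℕ) :
    (aeval (pencil n) (psum (Fin n) ℚ (a + b))).coeff b =
      ((a + b).choose b : ℚ) • ∑ i, X (Sum.inl i) ^ a * X (Sum.inr i) ^ b := by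
  simp only [psum, map_sum, map_pow, aeval_X, Polynomial.finsetSum_coeff, Finset.smul_sum]
  refine Finset.sum_congr rfl fun i _ => ?_
  rw [pencil, add_comm, add_pow, Polynomial.finsetSum_coeff, Finset.sum_eq_single b]
  · rw [mul_pow, ← map_pow, ← map_pow, ← Polynomial.C_eq_natCast, Polynomial.coeff_mul_C,
      Polynomial.coeff_mul_C, Polynomial.coeff_C_mul_X_pow, if_pos rfl, Nat.add_sub_cancel,
      Algebra.smul_def, map_natCast]
    ring
  · intro m _ hm
    rw [mul_pow, ← map_pow, ← map_pow, ← Polynomial.C_eq_natCast, Polynomial.coeff_mul_C,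
      Polynomial.coeff_mul_C, Polynomial.coeff_C_mul_X_pow, if_neg hm.symm, zero_mul, zero_mul]
  · intro hb
    simp at hb

/-- A subalgebra containing every `σ_{(r,s)}` contains the power sums `∑ z_i ^ a w_i ^ b`. -/
theorem sum_pow_mul_pow_mem {n : ℕ} {B : Subalgebra ℚ (MvPolynomial (Fin n ⊕ Fin n) ℚ)}
    (hB : ∀ r s, sigmaBis n r s ∈ B) (a b : ℕ) :
    ∑ i : Fin n, X (Sum.inl i) ^ a * X (Sum.inr i) ^ b ∈ B := by
  have hrange (p : Polynomial (MvPolynomial (Fin n ⊕ Fin n) ℚ)) :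
      p ∈ (Polynomial.mapAlgHom B.val).range ↔ ∀ k, p.coeff k ∈ B := by
    rw [← SetLike.mem_coe, AlgHom.coe_range]
    change p ∈ Set.range (Polynomial.map (B.val : B →+* _)) ↔ _
    rw [← Polynomial.lifts_iff_set_range, Polynomial.lifts_iff_coeff_lifts]
    simp
  have hp : aeval (pencil n) (psum (Fin n) ℚ (a + b)) ∈ (Polynomial.mapAlgHom B.val).range := by
    have hle : Algebra.adjoin ℚ (Set.range fun j : ℕ => esymm (Fin n) ℚ j) ≤
        (Polynomial.mapAlgHom B.val).range.comap (aeval (pencil n)) := by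
      refine Algebra.adjoin_le ?_
      rintro _ ⟨j, rfl⟩
      rw [SetLike.mem_coe, Subalgebra.mem_comap, hrange]
      intro s
      rcases lt_or_ge j s with h | h
      · simp only [coeff_aeval_pencil_esymm_of_lt n j s h, zero_mem]
      · obtain ⟨r, rfl⟩ := Nat.exists_eq_add_of_le' h
        simpa only [coeff_aeval_pencil_esymm] using hB r s
    exact hle (psum_mem_adjoin_esymm _ _ _)
  have h := (hrange _).1 hp b
  rw [coeff_aeval_pencil_psum] at h
  have hc : ((a + b).choose b : ℚ) ≠ 0 :=
    Nat.cast_ne_zero.2 (Nat.choose_pos (Nat.le_add_left b a)).ne'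
  simpa [smul_smul, inv_mul_cancel₀ hc] using B.smul_mem h ((a + b).choose b : ℚ)⁻¹

/-- A subalgebra containing every `σ_{(r,s)}` contains every symmetrization. -/
theorem sum_perm_rename_mem {n : ℕ} {B : Subalgebra ℚ (MvPolynomial (Fin n ⊕ Fin n) ℚ)}
    (hB : ∀ r s, sigmaBis n r s ∈ B) (p : MvPolynomial (Fin n ⊕ Fin n) ℚ) :
    ∑ π : Equiv.Perm (Fin n), rename (Sum.map π π) p ∈ B := by
  induction p using MvPolynomial.induction_on' with
  | add p q hp hq => simpa [Finset.sum_add_distrib] using add_mem hp hq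
  | monomial m c =>
    let G : Submonoid (Fin n → MvPolynomial (Fin n ⊕ Fin n) ℚ) :=
      { carrier := Set.range fun (x : ℕ × ℕ) i => X (Sum.inl i) ^ x.1 * X (Sum.inr i) ^ x.2
        one_mem' := ⟨0, by ext1; simp⟩
        mul_mem' := by
          rintro _ _ ⟨x, rfl⟩ ⟨y, rfl⟩
          refine ⟨x + y, ?_⟩
          ext1 i
          simp only [Prod.fst_add, Prod.snd_add, Pi.mul_apply]
          ring }
    have h := sum_embedding_prod_mem B G
      (by rintro _ ⟨x, rfl⟩; exact sum_pow_mul_pow_mem hB x.1 x.2) n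
      (fun j i => X (Sum.inl i) ^ m (Sum.inl j) * X (Sum.inr i) ^ m (Sum.inr j))
      fun j => ⟨(m (Sum.inl j), m (Sum.inr j)), rfl⟩
    rw [← (Equiv.embeddingEquivOfFinite (Fin n)).symm.sum_comp] at h
    convert B.smul_mem h c using 1
    rw [Finset.smul_sum]
    refine Finset.sum_congr rfl fun π _ => ?_
    rw [monomial_eq, Finsupp.prod_fintype _ _ (by simp), Fintype.prod_sum_type,
      ← Finset.prod_mul_distrib, map_mul, algHom_C, map_prod, Algebra.smul_def]
    simp

theorem mem_bisymmetricFunctions {n : ℕ} {p : MvPolynomial (Fin n ⊕ Fin n) ℚ} :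
    p ∈ bisymmetricFunctions n ↔ ∀ π : Equiv.Perm (Fin n), rename (Sum.map π π) p = p := by
  simp [bisymmetricFunctions, Algebra.mem_iInf, AlgHom.mem_equalizer]

theorem sigmaBis_mem_bisymmetricFunctions (n r s : ℕ) :
    sigmaBis n r s ∈ bisymmetricFunctions n := by
  rw [mem_bisymmetricFunctions]
  intro π
  have h : (Polynomial.mapAlgHom (rename (Sum.map π π))).comp (aeval (pencil n)) =
      (aeval (pencil n)).comp (rename (R := ℚ) π) := by
    ext1 i
    simp [pencil]
  have h' := DFunLike.congr_fun h (esymm (Fin n) ℚ (r + s))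
  rw [AlgHom.comp_apply, AlgHom.comp_apply, rename_esymm] at h'
  have hcoeff := congrArg (fun p => Polynomial.coeff p s) h'
  simpa [Polynomial.coeff_map, coeff_aeval_pencil_esymm] using hcoeff

/-- The ring of bisymmetric functions is generated, as a `ℚ`-algebra, by the
elementary bisymmetric functions `σ_{(r,s)}` with `1 ≤ r + s ≤ n`. -/
theorem bisymmetric_eq_adjoin_sigma (n : ℕ) (hn : 1 ≤ n) :
    bisymmetricFunctions n =
      Algebra.adjoin ℚ
        {p : MvPolynomial (Fin n ⊕ Fin n) ℚ |
          ∃ r s : ℕ, 1 ≤ r + s ∧ r + s ≤ n ∧ p = sigmaBis n r s} := by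
  refine le_antisymm (fun p hp => ?_) (Algebra.adjoin_le ?_)
  · rw [mem_bisymmetricFunctions] at hp
    have h := sum_perm_rename_mem (n := n) (B := Algebra.adjoin ℚ
        {p : MvPolynomial (Fin n ⊕ Fin n) ℚ |
          ∃ r s : ℕ, 1 ≤ r + s ∧ r + s ≤ n ∧ p = sigmaBis n r s}) (fun r s => ?_) p
    · simp only [hp, Finset.sum_const, Finset.card_univ, ← Nat.cast_smul_eq_nsmul ℚ] at h
      have hc : (Fintype.card (Equiv.Perm (Fin n)) : ℚ) ≠ 0 :=
        Nat.cast_ne_zero.2 Fintype.card_ne_zero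
      have h' := Subalgebra.smul_mem _ h (Fintype.card (Equiv.Perm (Fin n)) : ℚ)⁻¹
      rwa [smul_smul, inv_mul_cancel₀ hc, one_smul] at h'
    · rcases Nat.eq_zero_or_pos (r + s) with h0 | h0
      · obtain ⟨rfl, rfl⟩ : r = 0 ∧ s = 0 := by omega
        simp [sigmaBis]
      · rcases le_or_gt (r + s) n with hle | hlt
        · exact Algebra.subset_adjoin ⟨r, s, h0, hle, rfl⟩
        · have : sigmaBis n r s = 0 := by
            rw [← coeff_aeval_pencil_esymm, esymm, Finset.powersetCard_eq_empty.2 (by simpa)]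
            simp
          rw [this]
          exact zero_mem _
  · rintro _ ⟨r, s, -, -, rfl⟩
    exact sigmaBis_mem_bisymmetricFunctions n r s
end
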